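/- Let θ ∈ (0,1) and α ∈ (0, 1−θ). If f ∈ F_α satisfies T(f) = f, then f agrees almost everywhere with f_Bes(s) = (sin(πθ)/π) ∫_{s−1}^∞ t^{θ−1} (t+1)^{−1} dt; that is, f_Bes is THE unique fixed point of T in F_α. -/

import Mathlib

open MeasureTheory Real Set

/-- The operator `T` from the integral equation for crossing probabilities. -/
noncomputable def T (θ : ℝ) (f : ℝ → ℝ) : ℝ → ℝ :=
  fun s => 1 - (1 - 1 / s) ^ θ +
    θ * (s - 1) ^ θ * ∫ t in Ioi (1 : ℝ), (s + t - 1) ^ (-θ - 1) * f t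

/-- Membership in the space `F_α`: `f` is measurable, takes values in `[0,1]` on
`[1,∞)`, and `sup_{s ≥ 1} s^α |f s| < ∞`. -/
def MemF (α : ℝ) (f : ℝ → ℝ) : Prop :=
  Measurable f ∧ (∀ s, 1 ≤ s → f s ∈ Icc (0 : ℝ) 1) ∧
    BddAbove ((fun s => s ^ α * |f s|) '' Ici 1)

/-- The Bessel function `f_Bes(s) = (sin(πθ)/π) ∫_{s−1}^∞ t^{θ−1}(t+1)^{−1} dt`. -/
noncomputable def fBes (θ : ℝ) : ℝ → ℝ :=
  fun s => Real.sin (π * θ) / π * ∫ t in Ioi (s - 1), t ^ (θ - 1) * (t + 1)⁻¹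

open Filter Topology

/-- The density `t ↦ t^(θ-1) / (t+1)` defining `fBes`. -/
noncomputable def besDensity (θ t : ℝ) : ℝ := t ^ (θ - 1) * (t + 1)⁻¹

theorem besDensity_pos {θ t : ℝ} (ht : 0 < t) : 0 < besDensity θ t := by
  unfold besDensity; positivity

section Moebius

variable {x b : ℝ}

theorem image_moebius_Ioi (hx : 0 < x) (hb : 0 < b) :
    (fun t => x * t / (t + b)) '' Ioi 0 = Ioo 0 x := by
  ext u
  simp only [mem_image, mem_Ioi, mem_Ioo]
  constructor
  · rintro ⟨t, ht, rfl⟩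
    exact ⟨by positivity, by rw [div_lt_iff₀ (by positivity)]; nlinarith [mul_pos hx hb]⟩
  · rintro ⟨h0, h1⟩
    have h2 : 0 < x - u := sub_pos.2 h1
    refine ⟨b * u / (x - u), by positivity, ?_⟩
    have h3 : b * u / (x - u) + b = b * x / (x - u) := by field_simp; ring
    rw [h3]
    field_simp

theorem injOn_moebius_Ioi (hx : 0 < x) (hb : 0 < b) :
    InjOn (fun t => x * t / (t + b)) (Ioi 0) := by
  intro s hs t ht h
  simp only [mem_Ioi] at hs ht
  have h1 : s + b ≠ 0 := by positivity
  have h2 : t + b ≠ 0 := by positivity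
  have h3 : x * b ≠ 0 := by positivity
  simp only [div_eq_div_iff h1 h2] at h
  exact mul_left_cancel₀ h3 (by linarith)

theorem hasDerivAt_moebius (hb : 0 < b) {t : ℝ} (ht : 0 < t) :
    HasDerivAt (fun t => x * t / (t + b)) (x * b / (t + b) ^ 2) t := by
  have h : t + b ≠ 0 := by positivity
  convert! ((hasDerivAt_id t).const_mul x).div ((hasDerivAt_id t).add_const b) h using 1
  simp only [id]
  ring

theorem setIntegral_Ioo_eq_moebius (hx : 0 < x) (hb : 0 < b) (g : ℝ → ℝ) :
    ∫ u in Ioo 0 x, g u =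
      ∫ t in Ioi (0 : ℝ), x * b / (t + b) ^ 2 * g (x * t / (t + b)) := by
  rw [← image_moebius_Ioi hx hb, integral_image_eq_integral_abs_deriv_smul measurableSet_Ioi
    (fun t ht => (hasDerivAt_moebius hb ht).hasDerivWithinAt) (injOn_moebius_Ioi hx hb)]
  refine setIntegral_congr_fun measurableSet_Ioi fun t ht => ?_
  simp only [mem_Ioi] at ht
  have : 0 ≤ x * b / (t + b) ^ 2 := by positivity
  simp only [smul_eq_mul, abs_of_nonneg this]

end Moebius

theorem setIntegral_Ioo_rpow_mul_one_sub_rpow {a b : ℝ} (ha : 0 < a) (hb : 0 < b) :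
    ∫ u in Ioo (0 : ℝ) 1, u ^ (a - 1) * (1 - u) ^ (b - 1) =
      Real.Gamma a * Real.Gamma b / Real.Gamma (a + b) := by
  have h := ProbabilityTheory.lintegral_betaPDF_eq_one ha hb
  have hβ := ProbabilityTheory.beta_pos ha hb
  rw [ProbabilityTheory.lintegral_betaPDF, ← ENNReal.toReal_eq_one_iff,
    ← integral_eq_lintegral_of_nonneg_ae] at h
  · simp_rw [mul_assoc, integral_const_mul] at h
    rw [one_div, inv_mul_eq_one₀ hβ.ne'] at h
    exact h.symm
  · refine ae_restrict_of_forall_mem measurableSet_Ioo fun u hu => ?_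
    have h1 : 0 < 1 - u := sub_pos.2 hu.2
    have h0 : 0 < u := hu.1
    simp only [Pi.zero_apply]
    positivity
  · exact Measurable.aestronglyMeasurable (by fun_prop)

section

variable {θ : ℝ}

theorem sin_pi_mul_pos (hθ : θ ∈ Ioo (0 : ℝ) 1) : 0 < Real.sin (π * θ) :=
  Real.sin_pos_of_pos_of_lt_pi (mul_pos pi_pos hθ.1) (by nlinarith [pi_pos, hθ.2])

theorem integral_besDensity (hθ : θ ∈ Ioo (0 : ℝ) 1) :
    ∫ t in Ioi (0 : ℝ), besDensity θ t = π / Real.sin (π * θ) := by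
  have h := setIntegral_Ioo_rpow_mul_one_sub_rpow hθ.1 (sub_pos.2 hθ.2)
  rw [Real.Gamma_mul_Gamma_one_sub, add_sub_cancel, Real.Gamma_one, div_one,
    setIntegral_Ioo_eq_moebius one_pos one_pos] at h
  rw [← h]
  refine setIntegral_congr_fun measurableSet_Ioi fun t ht => ?_
  simp only [mem_Ioi] at ht
  have h1 : 0 < t + 1 := by positivity
  have h2 : 1 - t / (t + 1) = (t + 1)⁻¹ := by field_simp; ring
  simp only [besDensity, one_mul, mul_one, h2]
  rw [div_rpow ht.le h1.le, inv_rpow h1.le, ← rpow_neg h1.le, show -(1 - θ - 1) = θ by ring,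
    rpow_sub_one h1.ne' θ]
  field_simp

theorem integrableOn_besDensity (hθ : θ ∈ Ioo (0 : ℝ) 1) :
    IntegrableOn (besDensity θ) (Ioi 0) := by
  refine Integrable.of_integral_ne_zero ?_
  rw [integral_besDensity hθ]
  exact (div_pos pi_pos (sin_pi_mul_pos hθ)).ne'

theorem rpow_mul_integral_besDensity {x : ℝ} (hx : 0 < x) :
    x ^ θ * ∫ t in Ioi (0 : ℝ), besDensity θ t * (x + 1 + t) ^ (-θ) =
      ∫ u in Ioo 0 x, besDensity θ u := by
  rw [setIntegral_Ioo_eq_moebius hx (b := x + 1) (by positivity), ← integral_const_mul]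
  refine setIntegral_congr_fun measurableSet_Ioi fun t ht => ?_
  simp only [mem_Ioi] at ht
  have h1 : 0 < t + (x + 1) := by positivity
  have h2 : x * t / (t + (x + 1)) + 1 = (x + 1) * (t + 1) / (t + (x + 1)) := by
    field_simp; ring
  simp only [besDensity, h2]
  rw [div_rpow (by positivity) h1.le, mul_rpow hx.le ht.le, add_comm (x + 1) t,
    rpow_neg h1.le, rpow_sub_one hx.ne', rpow_sub_one h1.ne']
  field_simp

theorem fBes_eq (s : ℝ) :
    fBes θ s = Real.sin (π * θ) / π * ∫ t in Ioi (s - 1), besDensity θ t := rfl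

theorem fBes_one (hθ : θ ∈ Ioo (0 : ℝ) 1) : fBes θ 1 = 1 := by
  have := (sin_pi_mul_pos hθ).ne'
  rw [fBes_eq, sub_self, integral_besDensity hθ]
  field_simp

theorem fBes_eq_one_sub (hθ : θ ∈ Ioo (0 : ℝ) 1) {s : ℝ} (hs : 1 ≤ s) :
    fBes θ s = 1 - Real.sin (π * θ) / π * ∫ t in (0 : ℝ)..(s - 1), besDensity θ t := by
  have h := intervalIntegral.integral_Ioi_sub_Ioi (integrableOn_besDensity hθ) (sub_nonneg.2 hs)
  rw [← h, mul_sub, ← fBes_eq]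
  have h1 := fBes_one hθ
  rw [fBes_eq, sub_self] at h1
  rw [h1]
  ring

theorem fBes_mem_Icc (hθ : θ ∈ Ioo (0 : ℝ) 1) {s : ℝ} (hs : 1 ≤ s) :
    fBes θ s ∈ Icc (0 : ℝ) 1 := by
  have hc : 0 ≤ Real.sin (π * θ) / π := (div_pos (sin_pi_mul_pos hθ) pi_pos).le
  constructor
  · rw [fBes_eq]
    refine mul_nonneg hc (setIntegral_nonneg measurableSet_Ioi fun t ht => ?_)
    exact (besDensity_pos (lt_of_le_of_lt (sub_nonneg.2 hs) ht)).le
  · rw [fBes_eq_one_sub hθ hs, sub_le_self_iff,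
      intervalIntegral.integral_of_le (sub_nonneg.2 hs)]
    exact mul_nonneg hc (setIntegral_nonneg measurableSet_Ioc fun t ht => (besDensity_pos ht.1).le)

theorem hasDerivAt_fBes (hθ : θ ∈ Ioo (0 : ℝ) 1) {s : ℝ} (hs : 1 < s) :
    HasDerivAt (fBes θ) (-(Real.sin (π * θ) / π * besDensity θ (s - 1))) s := by
  have hs0 : 0 < s - 1 := sub_pos.2 hs
  have hcont : ContinuousOn (besDensity θ) (Ioi 0) := by
    intro t ht
    simp only [mem_Ioi] at ht
    have : t + 1 ≠ 0 := by positivity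
    exact ((continuousAt_id.rpow_const (Or.inl ht.ne')).mul
      ((continuousAt_id.add continuousAt_const).inv₀ this)).continuousWithinAt
  have h_int : IntervalIntegrable (besDensity θ) volume 0 (s - 1) := by
    rw [intervalIntegrable_iff_integrableOn_Ioc_of_le hs0.le]
    exact (integrableOn_besDensity hθ).mono_set Ioc_subset_Ioi_self
  have h := intervalIntegral.integral_hasDerivAt_right h_int
    (hcont.stronglyMeasurableAtFilter isOpen_Ioi _ hs0) (hcont.continuousAt (Ioi_mem_nhds hs0))
  have h2 := ((h.comp_sub_const s 1).const_mul (Real.sin (π * θ) / π)).const_sub 1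
  refine h2.congr_of_eventuallyEq ?_
  filter_upwards [Ioi_mem_nhds hs] with r hr using fBes_eq_one_sub hθ (le_of_lt hr)

theorem tendsto_fBes_atTop (hθ : θ ∈ Ioo (0 : ℝ) 1) : Tendsto (fBes θ) atTop (𝓝 0) := by
  have h := intervalIntegral_tendsto_integral_Ioi 0 (integrableOn_besDensity hθ)
    (tendsto_atTop_add_const_right atTop (-1 : ℝ) tendsto_id)
  have h2 := (h.const_mul (Real.sin (π * θ) / π)).const_sub 1
  rw [integral_besDensity hθ, div_mul_div_cancel₀ pi_ne_zero,
    div_self (sin_pi_mul_pos hθ).ne', sub_self] at h2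
  refine h2.congr' ?_
  filter_upwards [eventually_ge_atTop 1] with s hs
  rw [fBes_eq_one_sub hθ hs]
  rfl

theorem tendsto_fBes_nhdsGT_one (hθ : θ ∈ Ioo (0 : ℝ) 1) :
    Tendsto (fBes θ) (𝓝[>] 1) (𝓝 1) := by
  have h_int : IntegrableOn (besDensity θ) (Icc 0 1) := by
    rw [integrableOn_Icc_iff_integrableOn_Ioc]
    exact (integrableOn_besDensity hθ).mono_set Ioc_subset_Ioi_self
  have h := (intervalIntegral.continuousOn_primitive_interval
    (by rwa [uIcc_of_le zero_le_one])) 0 left_mem_uIcc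
  rw [uIcc_of_le zero_le_one, ContinuousWithinAt, intervalIntegral.integral_same] at h
  have hsub : Tendsto (fun s : ℝ => s - 1) (𝓝[>] 1) (𝓝[Icc 0 1] 0) := by
    refine tendsto_nhdsWithin_iff.2 ⟨?_, ?_⟩
    · have : Tendsto (fun s : ℝ => s - 1) (𝓝 1) (𝓝 (1 - 1)) :=
        (continuous_id.sub continuous_const).tendsto 1
      rw [sub_self] at this
      exact this.mono_left nhdsWithin_le_nhds
    · filter_upwards [Ioo_mem_nhdsGT (show (1 : ℝ) < 2 by norm_num)] with s hs
      exact ⟨by linarith [hs.1], by linarith [hs.2]⟩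
  have h2 := ((h.comp hsub).const_mul (Real.sin (π * θ) / π)).const_sub 1
  rw [mul_zero, sub_zero] at h2
  refine h2.congr' ?_
  filter_upwards [self_mem_nhdsWithin] with s hs
  rw [fBes_eq_one_sub hθ (le_of_lt hs)]
  rfl

theorem hasDerivAt_rpow_sub_kernel (s : ℝ) {t : ℝ} (h : 0 < s + t - 1) :
    HasDerivAt (fun t => s ^ (-θ) - (s + t - 1) ^ (-θ)) (θ * (s + t - 1) ^ (-θ - 1)) t := by
  have h1 : HasDerivAt (fun t => s + t - 1) 1 t := ((hasDerivAt_id t).const_add s).sub_const 1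
  convert! (h1.rpow_const (p := -θ) (Or.inl h.ne')).const_sub (s ^ (-θ)) using 1
  ring

theorem tendsto_rpow_sub_kernel_atTop (hθ : 0 < θ) (s : ℝ) :
    Tendsto (fun t => s ^ (-θ) - (s + t - 1) ^ (-θ)) atTop (𝓝 (s ^ (-θ))) := by
  have h1 : Tendsto (fun t : ℝ => s + t - 1) atTop atTop :=
    tendsto_atTop_add_const_right atTop (-1) (tendsto_atTop_add_const_left atTop s tendsto_id)
  simpa using ((tendsto_rpow_neg_atTop hθ).comp h1).const_sub (s ^ (-θ))

theorem integrableOn_kernel (hθ : 0 < θ) {s : ℝ} (hs : 0 < s) :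
    IntegrableOn (fun t => (s + t - 1) ^ (-θ - 1)) (Ioi 1) := by
  refine (integrableOn_add_rpow_Ioi_of_lt (a := -θ - 1) (c := 1) (m := s - 1)
    (by linarith) (by linarith)).congr_fun (fun t _ => ?_) measurableSet_Ioi
  ring_nf

theorem integral_kernel (hθ : 0 < θ) {s : ℝ} (hs : 0 < s) :
    θ * ∫ t in Ioi (1 : ℝ), (s + t - 1) ^ (-θ - 1) = s ^ (-θ) := by
  rw [← integral_const_mul, integral_Ioi_of_hasDerivAt_of_tendsto'
    (fun t ht => hasDerivAt_rpow_sub_kernel (θ := θ) s (by linarith [mem_Ici.1 ht]))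
    ((integrableOn_kernel hθ hs).const_mul θ) (tendsto_rpow_sub_kernel_atTop hθ s)]
  simp

theorem integrableOn_kernel_mul (hθ : 0 < θ) {s : ℝ} (hs : 0 < s) {g : ℝ → ℝ}
    (hg : AEStronglyMeasurable g (volume.restrict (Ioi 1))) {C : ℝ}
    (hC : ∀ t, 1 < t → |g t| ≤ C) :
    IntegrableOn (fun t => (s + t - 1) ^ (-θ - 1) * g t) (Ioi 1) :=
  (integrableOn_kernel hθ hs).mul_bdd (c := C) hg
    (ae_restrict_of_forall_mem measurableSet_Ioi hC)

theorem setIntegral_Ioi_comp_sub_one (g : ℝ → ℝ) :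
    ∫ t in Ioi (1 : ℝ), g (t - 1) = ∫ t in Ioi (0 : ℝ), g t := by
  have h := integral_image_eq_integral_abs_deriv_smul (s := Ioi (1 : ℝ)) (f := fun t => t - 1)
    (f' := fun _ => 1) measurableSet_Ioi
    (fun t _ => ((hasDerivAt_id t).sub_const 1).hasDerivWithinAt)
    (sub_left_injective.injOn) g
  simpa using h.symm

theorem integrableOn_besDensity_comp_sub_one (hθ : θ ∈ Ioo (0 : ℝ) 1) :
    IntegrableOn (fun t => besDensity θ (t - 1)) (Ioi 1) := by
  refine Integrable.of_integral_ne_zero ?_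
  rw [setIntegral_Ioi_comp_sub_one, integral_besDensity hθ]
  exact (div_pos pi_pos (sin_pi_mul_pos hθ)).ne'

theorem aestronglyMeasurable_fBes (hθ : θ ∈ Ioo (0 : ℝ) 1) :
    AEStronglyMeasurable (fBes θ) (volume.restrict (Ioi 1)) :=
  ContinuousOn.aestronglyMeasurable
    (fun _ ht => (hasDerivAt_fBes hθ ht).continuousAt.continuousWithinAt) measurableSet_Ioi

theorem abs_fBes_le_one (hθ : θ ∈ Ioo (0 : ℝ) 1) {s : ℝ} (hs : 1 ≤ s) : |fBes θ s| ≤ 1 :=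
  abs_le.2 ⟨by linarith [(fBes_mem_Icc hθ hs).1], (fBes_mem_Icc hθ hs).2⟩

theorem integrableOn_besDensity_mul_rpow (hθ : θ ∈ Ioo (0 : ℝ) 1) {s : ℝ} (hs : 1 ≤ s) :
    IntegrableOn (fun t => besDensity θ t * (s + t) ^ (-θ)) (Ioi 0) := by
  refine (integrableOn_besDensity hθ).mul_bdd (c := 1) ?_
    (ae_restrict_of_forall_mem measurableSet_Ioi fun t ht => ?_)
  · exact Measurable.aestronglyMeasurable (by fun_prop)
  · have ht : 0 < t := ht
    have h : 1 ≤ s + t := by linarith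
    rw [Real.norm_of_nonneg (by positivity)]
    exact rpow_le_one_of_one_le_of_nonpos h (by linarith [hθ.1])

theorem integral_kernel_mul_fBes (hθ : θ ∈ Ioo (0 : ℝ) 1) {s : ℝ} (hs : 1 ≤ s) :
    θ * ∫ t in Ioi (1 : ℝ), (s + t - 1) ^ (-θ - 1) * fBes θ t =
      s ^ (-θ) - Real.sin (π * θ) / π *
        ∫ t in Ioi (0 : ℝ), besDensity θ t * (s + t) ^ (-θ) := by
  have hs0 : 0 < s := by linarith
  set c := Real.sin (π * θ) / π with hc
  have hzero : Tendsto (fun t => s ^ (-θ) - (s + t - 1) ^ (-θ)) (𝓝[>] 1) (𝓝 0) := by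
    have h := (hasDerivAt_rpow_sub_kernel (θ := θ) s (t := 1) (by linarith)).continuousAt.tendsto
    simp only [add_sub_cancel_right, sub_self] at h
    exact h.mono_left nhdsWithin_le_nhds
  have hshift := setIntegral_Ioi_comp_sub_one
    (fun r => -(c * besDensity θ r) * (s ^ (-θ) - (s + r) ^ (-θ)))
  simp only [← add_sub_assoc] at hshift
  have hparts := integral_Ioi_mul_deriv_eq_deriv_mul (a := (1 : ℝ)) (u := fBes θ)
    (u' := fun t => -(c * besDensity θ (t - 1)))
    (v := fun t => s ^ (-θ) - (s + t - 1) ^ (-θ)) (v' := fun t => θ * (s + t - 1) ^ (-θ - 1))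
    (a' := 1 * 0) (b' := 0 * s ^ (-θ))
    (fun t ht => hasDerivAt_fBes hθ ht)
    (fun t ht => hasDerivAt_rpow_sub_kernel s (by linarith [mem_Ioi.1 ht]))
    (((integrableOn_kernel_mul hθ.1 hs0 (aestronglyMeasurable_fBes hθ)
      (fun t ht => abs_fBes_le_one hθ ht.le)).const_mul θ).congr
        (ae_of_all _ fun t => by simp only [Pi.mul_apply]; ring))
    (((integrableOn_besDensity_comp_sub_one hθ).const_mul c).neg.mul_bdd (c := s ^ (-θ))
      (Measurable.aestronglyMeasurable (by fun_prop))
      (ae_restrict_of_forall_mem measurableSet_Ioi fun t ht => by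
        have ht : 1 < t := ht
        have h1 : 0 ≤ (s + t - 1) ^ (-θ) := rpow_nonneg (by linarith) _
        have h2 : (s + t - 1) ^ (-θ) ≤ s ^ (-θ) :=
          rpow_le_rpow_of_nonpos hs0 (by linarith) (by linarith [hθ.1])
        rw [Real.norm_of_nonneg (by linarith)]
        linarith))
    ((tendsto_fBes_nhdsGT_one hθ).mul hzero)
    ((tendsto_fBes_atTop hθ).mul (tendsto_rpow_sub_kernel_atTop hθ.1 s))
  have hsplit : ∫ t in Ioi (0 : ℝ), -(c * besDensity θ t) * (s ^ (-θ) - (s + t) ^ (-θ)) =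
      -(s ^ (-θ) - c * ∫ t in Ioi (0 : ℝ), besDensity θ t * (s + t) ^ (-θ)) := by
    have h1 : c * ∫ t in Ioi (0 : ℝ), besDensity θ t = 1 := by
      have := (sin_pi_mul_pos hθ).ne'
      rw [integral_besDensity hθ, hc]
      field_simp
    calc _ = ∫ t in Ioi (0 : ℝ), (c * (besDensity θ t * (s + t) ^ (-θ)) -
          c * s ^ (-θ) * besDensity θ t) := by
            congr 1 with t
            ring
      _ = _ := by
        rw [integral_sub ((integrableOn_besDensity_mul_rpow hθ hs).const_mul c)
          ((integrableOn_besDensity hθ).const_mul _), integral_const_mul, integral_const_mul]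
        linear_combination (-s ^ (-θ)) * h1
  rw [hshift, hsplit] at hparts
  rw [← integral_const_mul]
  calc _ = ∫ t in Ioi (1 : ℝ), fBes θ t * (θ * (s + t - 1) ^ (-θ - 1)) := by
        congr 1 with t
        ring
    _ = _ := by rw [hparts]; ring

theorem T_fBes (hθ : θ ∈ Ioo (0 : ℝ) 1) {s : ℝ} (hs : 1 < s) : T θ (fBes θ) s = fBes θ s := by
  have hs0 : 0 < s := by linarith
  have hs1 : 0 < s - 1 := sub_pos.2 hs
  have h := rpow_mul_integral_besDensity (θ := θ) hs1
  rw [sub_add_cancel] at h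
  have hk := integral_kernel_mul_fBes hθ hs.le
  have hpow : (1 - 1 / s) ^ θ = (s - 1) ^ θ * s ^ (-θ) := by
    rw [rpow_neg hs0.le, ← div_eq_mul_inv, ← div_rpow hs1.le hs0.le, sub_div, div_self hs0.ne']
  rw [fBes_eq_one_sub hθ hs.le, intervalIntegral.integral_of_le hs1.le,
    integral_Ioc_eq_integral_Ioo, ← h, T, hpow]
  linear_combination (s - 1) ^ θ * hk

/-- A bounded measurable function vanishing at infinity that is fixed by the linear part of `T`
vanishes identically. -/
theorem eq_zero_of_kernel_fixed (hθ : 0 < θ) {h : ℝ → ℝ}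
    (hmeas : AEStronglyMeasurable h (volume.restrict (Ioi 1))) {C : ℝ}
    (hC : ∀ t, 1 < t → |h t| ≤ C) (hlim : Tendsto h atTop (𝓝 0))
    (hfix : ∀ s, 1 < s →
      h s = θ * (s - 1) ^ θ * ∫ t in Ioi (1 : ℝ), (s + t - 1) ^ (-θ - 1) * h t) :
    ∀ s, 1 < s → h s = 0 := by
  set S : Set ℝ := (fun t => |h t|) '' Ioi 1 with hS
  have hbdd : BddAbove S := ⟨C, by rintro _ ⟨t, ht, rfl⟩; exact hC t ht⟩
  have hne : S.Nonempty := ⟨_, 2, by norm_num, rfl⟩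
  set M := sSup S with hM
  have hle : ∀ t, 1 < t → |h t| ≤ M := fun t ht => le_csSup hbdd ⟨t, ht, rfl⟩
  have hM0 : 0 ≤ M := (abs_nonneg _).trans (hle 2 (by norm_num))
  have hcontr : ∀ s, 1 < s → |h s| ≤ ((s - 1) / s) ^ θ * M := by
    intro s hs
    have hs0 : 0 < s := by linarith
    have hs1 : 0 < s - 1 := sub_pos.2 hs
    have hker : ∀ t ∈ Ioi (1 : ℝ), 0 ≤ (s + t - 1) ^ (-θ - 1) := fun t ht =>
      rpow_nonneg (by linarith [mem_Ioi.1 ht]) _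
    have h_int : |∫ t in Ioi (1 : ℝ), (s + t - 1) ^ (-θ - 1) * h t| ≤
        (∫ t in Ioi (1 : ℝ), (s + t - 1) ^ (-θ - 1)) * M := by
      rw [← integral_mul_const]
      refine (abs_integral_le_integral_abs).trans (setIntegral_mono_on
        (integrableOn_kernel_mul hθ hs0 hmeas hC).abs
        ((integrableOn_kernel hθ hs0).mul_const M) measurableSet_Ioi fun t ht => ?_)
      rw [abs_mul, abs_of_nonneg (hker t ht)]
      exact mul_le_mul_of_nonneg_left (hle t ht) (hker t ht)
    rw [hfix s hs, abs_mul, abs_of_nonneg (by positivity), div_rpow hs1.le hs0.le,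
      div_eq_mul_inv, ← rpow_neg hs0.le, ← integral_kernel hθ hs0]
    refine (mul_le_mul_of_nonneg_left h_int (by positivity)).trans_eq ?_
    ring
  have hMzero : M = 0 := by
    by_contra hMne
    have hMpos : 0 < M := lt_of_le_of_ne hM0 (Ne.symm hMne)
    have habs : Tendsto (fun t => |h t|) atTop (𝓝 0) := by simpa using hlim.abs
    obtain ⟨R, hR⟩ := eventually_atTop.1 (habs.eventually (gt_mem_nhds (half_pos hMpos)))
    set R' := max R 2 with hR'
    have hR2 : 2 ≤ R' := le_max_right _ _
    have hR0 : 0 < R' := by linarith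
    set q := ((R' - 1) / R') ^ θ with hq
    have hq1 : q < 1 := rpow_lt_one (div_nonneg (by linarith) hR0.le)
      ((div_lt_one hR0).2 (by linarith)) hθ
    have hsup : M ≤ max (M / 2) (q * M) := by
      refine csSup_le hne ?_
      rintro _ ⟨t, ht, rfl⟩
      have ht : 1 < t := ht
      rcases le_total R' t with h1 | h1
      · exact (hR t ((le_max_left _ _).trans h1)).le.trans (le_max_left _ _)
      · refine (hcontr t ht).trans (le_trans ?_ (le_max_right _ _))
        refine mul_le_mul_of_nonneg_right (rpow_le_rpow
          (div_nonneg (by linarith) (by linarith)) ?_ hθ.le) hM0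
        rw [div_le_div_iff₀ (by linarith) hR0]
        linarith
    exact absurd hsup (not_le.2 (max_lt (half_lt_self hMpos) (by nlinarith)))
  intro s hs
  exact abs_eq_zero.1 (le_antisymm ((hle s hs).trans_eq hMzero) (abs_nonneg _))

theorem MemF.tendsto_atTop {α : ℝ} (hα : 0 < α) {f : ℝ → ℝ} (hf : MemF α f) :
    Tendsto f atTop (𝓝 0) := by
  obtain ⟨C, hC⟩ := hf.2.2
  have h : Tendsto (fun s : ℝ => C * s ^ (-α)) atTop (𝓝 0) := by
    simpa using (tendsto_rpow_neg_atTop hα).const_mul C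
  refine squeeze_zero_norm' ?_ h
  filter_upwards [eventually_ge_atTop 1] with s hs
  have hs0 : 0 < s := by linarith
  have h1 : s ^ α * |f s| ≤ C := hC ⟨s, hs, rfl⟩
  rw [Real.norm_eq_abs, rpow_neg hs0.le, ← div_eq_mul_inv, le_div_iff₀ (by positivity)]
  linarith

end

/-- For `θ ∈ (0,1)` and `α ∈ (0, 1−θ)`: any fixed point of `T` in
`F_α` agrees almost everywhere on `[1,∞)` with `f_Bes`; i.e. `f_Bes` is the unique
fixed point of `T` in `F_α`. -/
theorem fixed_point_is_fBes (θ α : ℝ) (hθ : θ ∈ Ioo (0 : ℝ) 1)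
    (hα : α ∈ Ioo (0 : ℝ) (1 - θ)) (f : ℝ → ℝ) (hf : MemF α f)
    (hfix : ∀ s, 1 ≤ s → T θ f s = f s) :
    ∀ᵐ s ∂(volume.restrict (Ici (1 : ℝ))), f s = fBes θ s := by
  have key := eq_zero_of_kernel_fixed (h := fun s => f s - fBes θ s) (C := 1) hθ.1
    (hf.1.aestronglyMeasurable.sub (aestronglyMeasurable_fBes hθ))
    (fun t ht => by
      have h1 := hf.2.1 t ht.le
      have h2 := fBes_mem_Icc hθ ht.le
      exact abs_le.2 ⟨by linarith [h1.1, h2.2], by linarith [h1.2, h2.1]⟩)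
    (by simpa using (hf.tendsto_atTop hα.1).sub (tendsto_fBes_atTop hθ))
    (fun s hs => by
      have hs0 : 0 < s := by linarith
      simp only [mul_sub]
      rw [integral_sub
        (integrableOn_kernel_mul hθ.1 hs0 hf.1.aestronglyMeasurable (C := 1) fun t ht =>
          abs_le.2 ⟨by linarith [(hf.2.1 t ht.le).1], (hf.2.1 t ht.le).2⟩)
        (integrableOn_kernel_mul hθ.1 hs0 (aestronglyMeasurable_fBes hθ) fun t ht =>
          abs_fBes_le_one hθ ht.le)]
      have h1 := hfix s hs.le
      have h2 := T_fBes hθ hs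
      rw [T] at h1 h2
      linear_combination h2 - h1)
  rw [← restrict_Ioi_eq_restrict_Ici]
  exact ae_restrict_of_forall_mem measurableSet_Ioi fun s hs => sub_eq_zero.1 (key s hs)
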